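/- arXiv:2410.12455 — 3 statements merged into one kernel-verified Lean document; each statement's English description precedes it below -/
import Mathlib

section
/- Convergence of DecSPS (SPS with decreasing stepsize parameter) under the α-β-condition: Suppose f satisfies the α-β-condition on ℝ^d with parameters α > β > 0, each f_i is L-smooth, σ_int² is finite, and along every index sequence and every iteration ∇f_{i_k}(x^k) ≠ 0. Let {c_k}_{k ≥ 0} be a positive non-decreasing sequence with c_k ≥ 1/(α − β) for all k, set c_{−1} = c_0 and γ_{−1} = γ_b > 0, and run x^{k+1} = x^k − γ_k ∇f_{i_k}(x^k) with γ_k := (1/c_k)·min{ (f_{i_k}(x^k) − f_{i_k}*)/‖∇f_{i_k}(x^k)‖², c_{k−1}γ_{k−1} }. Assume dist(x^k,𝒮)² ≤ D² for all 0 ≤ k ≤ K and every index sequence. Then, with L̃ := max{L, 1/(2c_0γ_b)}, min_{0 ≤ k < K} E[f(x^k) − f*] ≤ 2L̃·D²·c_{K−1}/(K(α − β)) + (2β/(α − β))·σ_int² + (1/K)·∑_{k=0}^{K−1} σ_int²/((α − β)·c_k). -/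
open scoped RealInnerProductSpace BigOperators

lemma aux_descent {d : ℕ} (g : EuclideanSpace ℝ (Fin d) → ℝ) (hg : Differentiable ℝ g)
    (L : ℝ) (hL : 0 < L)
    (hs : ∀ x y, ‖gradient g x - gradient g y‖ ≤ L * ‖x - y‖)
    (m : ℝ) (hm : ∀ y, m ≤ g y) (x : EuclideanSpace ℝ (Fin d)) :
    ‖gradient g x‖ ^ 2 ≤ 2 * L * (g x - m) := by
  set v := gradient g x with hv
  have hder : ∀ t : ℝ, HasDerivAt (fun t : ℝ => g (x - t • v) + t * ‖v‖^2 - L * t^2 / 2 * ‖v‖^2)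
      (- ⟪gradient g (x - t • v), v⟫ + ‖v‖^2 - L * t * ‖v‖^2) t := by
    intro t
    have h1 : HasDerivAt (fun t : ℝ => x - t • v) (-v) t := by
      have := ((hasDerivAt_id t).smul_const v).const_sub x
      simpa using this
    have h2 : HasFDerivAt g (InnerProductSpace.toDual ℝ _ (gradient g (x - t • v))) (x - t • v) :=
      ((hg (x - t • v)).hasGradientAt).hasFDerivAt
    have h3 : HasDerivAt (fun t : ℝ => g (x - t • v)) _ t := h2.comp_hasDerivAt t h1
    have h4 : HasDerivAt (fun t : ℝ => t * ‖v‖^2) (1 * ‖v‖^2) t :=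
      (hasDerivAt_id t).mul_const _
    have h5 : HasDerivAt (fun t : ℝ => L * t^2 / 2 * ‖v‖^2) (L * t * ‖v‖^2) t := by
      have := ((((hasDerivAt_id t).pow 2).const_mul L).div_const 2).mul_const (‖v‖^2)
      refine this.congr_deriv ?_
      show L * (((2:ℕ):ℝ) * t ^ 1 * 1) / 2 * ‖v‖^2 = _
      push_cast
      ring
    refine ((h3.add h4).sub h5).congr_deriv ?_
    simp
  have hanti : AntitoneOn (fun t : ℝ => g (x - t • v) + t * ‖v‖^2 - L * t^2 / 2 * ‖v‖^2)
      (Set.Ici 0) := by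
    apply antitoneOn_of_deriv_nonpos (convex_Ici 0)
    · exact fun t _ => (hder t).continuousAt.continuousWithinAt
    · exact fun t _ => (hder t).differentiableAt.differentiableWithinAt
    · intro t ht
      rw [interior_Ici, Set.mem_Ioi] at ht
      rw [(hder t).deriv]
      have h1 : ⟪v - gradient g (x - t • v), v⟫ ≤ L * t * ‖v‖^2 := by
        refine (real_inner_le_norm _ _).trans ?_
        have := hs x (x - t • v)
        rw [sub_sub_cancel, norm_smul, Real.norm_of_nonneg ht.le, ← hv] at this
        nlinarith [norm_nonneg v]
      rw [inner_sub_left, real_inner_self_eq_norm_sq] at h1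
      linarith
  have h := hanti (Set.mem_Ici.2 le_rfl) (Set.mem_Ici.2 (by positivity : (0:ℝ) ≤ 1 / L))
    (by positivity)
  simp only [zero_smul, sub_zero] at h
  have hm' := hm (x - (1 / L) • v)
  have e : L * (1 / L)^2 / 2 * ‖v‖^2 = 1 / L * ‖v‖^2 / 2 := by field_simp
  rw [e] at h
  have : 1 / L * ‖v‖^2 / 2 ≤ g x - m := by linarith
  have h2 := mul_le_mul_of_nonneg_left this (by positivity : 0 ≤ 2 * L)
  have e2 : 2 * L * (1 / L * ‖v‖^2 / 2) = ‖v‖^2 := by field_simp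
  linarith

lemma aux_update {K n : ℕ} (k : Fin K) (h : (Fin K → Fin n) → ℝ) :
    ∑ ω : Fin K → Fin n, ∑ i, h (Function.update ω k i) = n * ∑ ω, h ω := by
  have : ∑ p : (Fin K → Fin n) × Fin n, h (Function.update p.1 k p.2)
      = ∑ p : (Fin K → Fin n) × Fin n, h p.1 := by
    apply Fintype.sum_bijective (fun p : (Fin K → Fin n) × Fin n =>
      ((Function.update p.1 k p.2, p.1 k) : (Fin K → Fin n) × Fin n))
    · apply Function.Involutive.bijective
      rintro ⟨ω, i⟩
      simp
    · intro p; rfl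
  rw [Fintype.sum_prod_type, Fintype.sum_prod_type] at this
  rw [this, Finset.mul_sum]
  simp

lemma aux_tele (a γ : ℕ → ℝ) (M : ℝ) (m : ℕ) (ha : ∀ k ≤ m + 1, a k ≤ M)
    (hpos : ∀ k ≤ m, 0 < γ k) (hmono : ∀ k < m, γ (k + 1) ≤ γ k) :
    ∑ k ∈ Finset.range (m + 1), (a k - a (k + 1)) / γ k ≤ (M - a (m + 1)) / γ m := by
  induction m with
  | zero =>
    simp only [zero_add, Finset.range_one, Finset.sum_singleton]
    have := hpos 0 le_rfl
    have := ha 0 (by omega)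
    gcongr
  | succ m ih =>
    rw [Finset.sum_range_succ]
    have h1 := ih (fun k hk => ha k (by omega)) (fun k hk => hpos k (by omega))
      (fun k hk => hmono k (by omega))
    have h2 : (M - a (m + 1)) / γ m ≤ (M - a (m + 1)) / γ (m + 1) := by
      apply div_le_div_of_nonneg_left _ (hpos _ le_rfl) (hmono m (by omega))
      linarith [ha (m + 1) (by omega)]
    calc _ ≤ (M - a (m + 1)) / γ (m + 1) + (a (m + 1) - a (m + 1 + 1)) / γ (m + 1) := by linarith
      _ = _ := by rw [← add_div]; congr 1; ring

lemma aux_final (K : ℕ) (hK : 0 < K) (e c : ℕ → ℝ) (A β σ Q : ℝ) (hA : 0 < A)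
    (h : ∑ k ∈ Finset.range K, (A * e k - (2 * β + 1 / c k) * σ) ≤ Q) :
    ∃ k < K, e k ≤ Q / (K * A) + 2 * β / A * σ
       + (1 / K) * ∑ k ∈ Finset.range K, σ / (A * c k) := by
  by_contra! hcon
  set B := Q / (K * A) + 2 * β / A * σ + (1 / K) * ∑ k ∈ Finset.range K, σ / (A * c k) with hB
  have hK' : (0:ℝ) < K := by exact_mod_cast hK
  have h1 : ∑ k ∈ Finset.range K, (A * B - (2 * β + 1 / c k) * σ) <
      ∑ k ∈ Finset.range K, (A * e k - (2 * β + 1 / c k) * σ) := by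
    apply Finset.sum_lt_sum_of_nonempty (by simpa using hK.ne')
    intro k hk
    have := mul_lt_mul_of_pos_left (hcon k (Finset.mem_range.1 hk)) hA
    linarith
  have h2 : ∑ k ∈ Finset.range K, (A * B - (2 * β + 1 / c k) * σ) = Q := by
    have e1 : ∑ k ∈ Finset.range K, σ / (A * c k) = (∑ k ∈ Finset.range K, σ / c k) / A := by
      rw [Finset.sum_div]
      refine Finset.sum_congr rfl fun k _ => ?_
      rw [div_div, mul_comm]
    have e2 : ∑ k ∈ Finset.range K, (A * B - (2 * β + 1 / c k) * σ)
        = K * (A * B - 2 * β * σ) - ∑ k ∈ Finset.range K, σ / c k := by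
      have : ∀ k ∈ Finset.range K, (A * B - (2 * β + 1 / c k) * σ)
        = (A * B - 2 * β * σ) - σ / c k := fun k _ => by ring
      rw [Finset.sum_congr rfl this, Finset.sum_sub_distrib]
      simp
      ring
    rw [e2, hB, e1]
    field_simp
    ring
  linarith

/-- Convergence of DecSPS (SPS with decreasing stepsize parameter) under the α-β-condition. -/
theorem decsps_abc
    {d n : ℕ} (hn : 0 < n)
    (F : Fin n → EuclideanSpace ℝ (Fin d) → ℝ)
    (hdiff : ∀ i, Differentiable ℝ (F i))
    (hbdd : ∀ i, BddBelow (Set.range (F i)))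
    (Fstar : Fin n → ℝ) (hFstar : ∀ i, Fstar i = ⨅ x, F i x)
    (f : EuclideanSpace ℝ (Fin d) → ℝ)
    (hf : f = fun x => (1 / (n : ℝ)) * ∑ i, F i x)
    (S : Set (EuclideanSpace ℝ (Fin d)))
    (hS : S = {x | ∀ y, f x ≤ f y}) (hSne : S.Nonempty)
    (fstar : ℝ) (hfstar : fstar = ⨅ x, f x)
    (σint2 : ℝ) (hσ : σint2 = fstar - (1 / (n : ℝ)) * ∑ i, Fstar i)
    (α β L : ℝ) (hβ : 0 < β) (hαβ : β < α) (hL : 0 < L)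
    (habc : ∀ x : EuclideanSpace ℝ (Fin d), ∃ xp ∈ S,
      dist x xp = Metric.infDist x S ∧
      ∀ i, α * (F i x - F i xp) - β * (F i x - Fstar i)
        ≤ ⟪gradient (F i) x, x - xp⟫)
    (hsmooth : ∀ i (x y : EuclideanSpace ℝ (Fin d)),
      ‖gradient (F i) x - gradient (F i) y‖ ≤ L * ‖x - y‖)
    (c : ℕ → ℝ) (hcpos : ∀ k, 0 < c k) (hcmono : Monotone c)
    (hclb : ∀ k, 1 / (α - β) ≤ c k)
    (γb : ℝ) (hγb : 0 < γb)
    (K : ℕ) (hK : 0 < K)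
    (x0 : EuclideanSpace ℝ (Fin d))
    (x : (Fin K → Fin n) → ℕ → EuclideanSpace ℝ (Fin d))
    (γs : (Fin K → Fin n) → ℕ → ℝ)
    (hx0 : ∀ ω, x ω 0 = x0)
    (hgrad : ∀ ω (k : Fin K), gradient (F (ω k)) (x ω k) ≠ 0)
    (hγs : ∀ ω (k : Fin K),
      γs ω (k : ℕ)
        = (1 / c (k : ℕ))
          * min ((F (ω k) (x ω k) - Fstar (ω k)) / ‖gradient (F (ω k)) (x ω k)‖ ^ 2)
              (if (k : ℕ) = 0 then c 0 * γb else c ((k : ℕ) - 1) * γs ω ((k : ℕ) - 1)))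
    (hstep : ∀ ω (k : Fin K),
      x ω ((k : ℕ) + 1) = x ω k - γs ω (k : ℕ) • gradient (F (ω k)) (x ω k))
    (D : ℝ) (hD : ∀ ω (k : ℕ), k ≤ K → Metric.infDist (x ω k) S ^ 2 ≤ D ^ 2)
    (Lt : ℝ) (hLt : Lt = max L (1 / (2 * c 0 * γb))) :
    ∃ k < K,
      (1 / (n : ℝ) ^ K) * ∑ ω : Fin K → Fin n, (f (x ω k) - fstar)
        ≤ 2 * Lt * D ^ 2 * c (K - 1) / (K * (α - β))
          + 2 * β / (α - β) * σint2
          + (1 / K) * ∑ k ∈ Finset.range K, σint2 / ((α - β) * c k) := by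
  classical
  have hA : 0 < α - β := by linarith
  have hn' : (0:ℝ) < n := by exact_mod_cast hn
  have hFs : ∀ i y, Fstar i ≤ F i y := fun i y => by
    rw [hFstar]; exact ciInf_le (hbdd i) y
  have hdesc : ∀ i y, ‖gradient (F i) y‖ ^ 2 ≤ 2 * L * (F i y - Fstar i) := fun i y =>
    aux_descent (F i) (hdiff i) L hL (hsmooth i) _ (hFs i) y
  have hfS : ∀ y ∈ S, f y = fstar := by
    intro y hy
    rw [hS] at hy
    rw [hfstar]
    apply le_antisymm
    · exact le_ciInf hy
    · exact ciInf_le ⟨f y, by rintro _ ⟨z, rfl⟩; exact hy z⟩ y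
  have hfge : ∀ y, fstar ≤ f y := by
    obtain ⟨z, hz⟩ := hSne
    intro y
    rw [← hfS z hz]
    rw [hS] at hz
    exact hz y
  choose P hPS hPd hPabc using habc
  have hLt1 : L ≤ Lt := hLt ▸ le_max_left _ _
  have hLt2 : 1 / (2 * c 0 * γb) ≤ Lt := hLt ▸ le_max_right _ _
  have hLtpos : 0 < Lt := lt_of_lt_of_le hL hLt1
  -- lower bound on steps
  have hquot : ∀ ω (k : Fin K), 1 / (2 * Lt) ≤
      (F (ω k) (x ω k) - Fstar (ω k)) / ‖gradient (F (ω k)) (x ω k)‖ ^ 2 := by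
    intro ω k
    have hp : 0 < ‖gradient (F (ω k)) (x ω k)‖ := norm_pos_iff.2 (hgrad ω k)
    rw [div_le_div_iff₀ (by positivity) (by positivity)]
    have h1 := hdesc (ω k) (x ω k)
    have h2 := hFs (ω k) (x ω k)
    nlinarith [mul_nonneg (sub_nonneg.2 hLt1) (sub_nonneg.2 h2)]
  have hlow : ∀ ω (k : ℕ), k < K → 1 / (2 * Lt) ≤ c k * γs ω k := by
    intro ω k
    induction k with
    | zero =>
      intro hk
      have := hγs ω ⟨0, hk⟩
      have hq := hquot ω ⟨0, hk⟩
      simp only [if_true] at this hq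
      rw [this, ← mul_assoc, mul_one_div_cancel (hcpos 0).ne', one_mul]
      refine le_min hq ?_
      have hc0 := hcpos 0
      rw [div_le_iff₀ (by positivity)] at hLt2 ⊢
      nlinarith
    | succ k ih =>
      intro hk
      have := hγs ω ⟨k + 1, hk⟩
      have hq := hquot ω ⟨k + 1, hk⟩
      simp only [Nat.add_eq_zero_iff, one_ne_zero, and_false, if_false, Nat.add_sub_cancel] at this hq
      rw [this, ← mul_assoc, mul_one_div_cancel (hcpos _).ne', one_mul]
      exact le_min hq (ih (by omega))
  have hγpos : ∀ ω (k : ℕ), k < K → 0 < γs ω k := by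
    intro ω k hk
    have h1 := hlow ω k hk
    have h2 : 0 < 1 / (2 * Lt) := by positivity
    exact pos_of_mul_pos_right (h2.trans_le h1) (hcpos k).le
  have hγmono : ∀ ω (k : ℕ), k + 1 < K → γs ω (k + 1) ≤ γs ω k := by
    intro ω k hk
    have := hγs ω ⟨k + 1, hk⟩
    simp only [Nat.add_eq_zero_iff, one_ne_zero, and_false, if_false, Nat.add_sub_cancel] at this
    have h2 : c (k+1) * γs ω (k+1) ≤ c k * γs ω k := by
      rw [this, ← mul_assoc, mul_one_div_cancel (hcpos _).ne', one_mul]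
      exact min_le_right _ _
    have h3 : c k * γs ω k ≤ c (k+1) * γs ω k :=
      mul_le_mul_of_nonneg_right (hcmono (by omega)) (hγpos ω k (by omega)).le
    exact le_of_mul_le_mul_left (h2.trans h3) (hcpos _)
  have hγup : ∀ ω (k : Fin K), γs ω k * ‖gradient (F (ω k)) (x ω k)‖ ^ 2 ≤
      1 / c k * (F (ω k) (x ω k) - Fstar (ω k)) := by
    intro ω k
    have hp : 0 < ‖gradient (F (ω k)) (x ω k)‖ := norm_pos_iff.2 (hgrad ω k)
    have hck := hcpos k
    have h1 : γs ω k ≤ 1 / c k *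
        ((F (ω k) (x ω k) - Fstar (ω k)) / ‖gradient (F (ω k)) (x ω k)‖ ^ 2) := by
      rw [hγs ω k]
      exact mul_le_mul_of_nonneg_left (min_le_left _ _) (by positivity)
    calc _ ≤ _ := mul_le_mul_of_nonneg_right h1 (by positivity)
      _ = _ := by field_simp
  -- adaptedness
  have hadapt : ∀ (k : ℕ), k ≤ K → ∀ ω ω' : Fin K → Fin n, (∀ j : Fin K, (j:ℕ) < k → ω j = ω' j) →
      x ω k = x ω' k ∧ (0 < k → γs ω (k - 1) = γs ω' (k - 1)) := by
    intro k
    induction k with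
    | zero => intro _ ω ω' _; exact ⟨by rw [hx0, hx0], fun h => absurd h (lt_irrefl _)⟩
    | succ k ih =>
      intro hk ω ω' hω
      obtain ⟨h1, h2⟩ := ih (by omega) ω ω' (fun j hj => hω j (by omega))
      have h3 : ω ⟨k, hk⟩ = ω' ⟨k, hk⟩ := hω _ (by simp)
      have hγ : γs ω k = γs ω' k := by
        have e1 := hγs ω ⟨k, hk⟩
        have e2 := hγs ω' ⟨k, hk⟩
        simp only at e1 e2
        rw [e1, e2, h3, h1]
        rcases Nat.eq_zero_or_pos k with h0 | h0
        · simp [h0]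
        · rw [h2 h0]
      refine ⟨?_, fun _ => by simpa using hγ⟩
      have e1 := hstep ω ⟨k, hk⟩
      have e2 := hstep ω' ⟨k, hk⟩
      simp only at e1 e2
      rw [e1, e2, h3, h1, hγ]
  -- one step
  have hone : ∀ ω (k : Fin K),
      (2 * α - 2 * β - 1 / c k) * (F (ω k) (x ω k) - F (ω k) (P (x ω k)))
        - (2 * β + 1 / c k) * (F (ω k) (P (x ω k)) - Fstar (ω k)) ≤
      (Metric.infDist (x ω k) S ^ 2 - Metric.infDist (x ω (k + 1)) S ^ 2) / γs ω k := by
    intro ω k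
    have hγ := hγpos ω k k.2
    rw [le_div_iff₀ hγ]
    have h1 : Metric.infDist (x ω (k + 1)) S ≤ ‖x ω (k+1) - P (x ω k)‖ := by
      rw [← dist_eq_norm]; exact Metric.infDist_le_dist_of_mem (hPS _)
    have h2 : Metric.infDist (x ω (k + 1)) S ^ 2 ≤ ‖x ω (k+1) - P (x ω k)‖ ^ 2 :=
      pow_le_pow_left₀ Metric.infDist_nonneg h1 2
    have h3 : x ω (k+1) - P (x ω k) = (x ω k - P (x ω k)) - γs ω k • gradient (F (ω k)) (x ω k) := by
      rw [hstep ω k]; abel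
    rw [h3, norm_sub_sq_real, ← dist_eq_norm, hPd, inner_smul_right, norm_smul, mul_pow,
      Real.norm_of_nonneg hγ.le, real_inner_comm] at h2
    have h4 := mul_le_mul_of_nonneg_left (hPabc (x ω k) (ω k)) hγ.le
    have h5 := mul_le_mul_of_nonneg_left (hγup ω k) hγ.le
    nlinarith
  -- sum over index sequences
  have hsum : ∀ k : Fin K, ∑ ω : Fin K → Fin n, ((α - β) * (f (x ω k) - fstar) - (2 * β + 1 / c k) * σint2)
      ≤ ∑ ω : Fin K → Fin n,
        (Metric.infDist (x ω k) S ^ 2 - Metric.infDist (x ω (k + 1)) S ^ 2) / γs ω k := by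
    intro k
    refine le_trans ?_ (Finset.sum_le_sum fun ω _ => hone ω k)
    refine le_of_mul_le_mul_left ?_ hn'
    refine le_of_le_of_eq ?_ (aux_update k _)
    rw [Finset.mul_sum]
    refine Finset.sum_le_sum fun ω _ => ?_
    have hx : ∀ i, x (Function.update ω k i) k = x ω k := fun i =>
      (hadapt k k.2.le _ _ (fun j hj => by
        rw [Function.update_of_ne]; rintro rfl; exact lt_irrefl _ hj)).1
    simp only [hx, Function.update_self]
    rw [Finset.sum_sub_distrib, ← Finset.mul_sum, ← Finset.mul_sum, Finset.sum_sub_distrib,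
      Finset.sum_sub_distrib]
    have hfn : ∀ y, ∑ i, F i y = n * f y := by
      intro y; rw [hf]; field_simp
    have hsn : ∑ i, Fstar i = n * (fstar - σint2) := by rw [hσ]; field_simp; ring
    rw [hfn, hfn, hsn, hfS _ (hPS _)]
    have hc : 1 / c k ≤ α - β := by
      have := hclb k
      rw [div_le_iff₀ hA] at this
      rw [div_le_iff₀ (hcpos _)]; linarith
    have h6 : (α - β) * (f (x ω k) - fstar) ≤ (2 * α - 2 * β - 1 / c k) * (f (x ω k) - fstar) :=
      mul_le_mul_of_nonneg_right (by linarith) (sub_nonneg.2 (hfge _))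
    have := mul_le_mul_of_nonneg_left h6 hn'.le
    linarith
  -- telescoping
  have htel : ∀ ω : Fin K → Fin n, ∑ k ∈ Finset.range K,
      (Metric.infDist (x ω k) S ^ 2 - Metric.infDist (x ω (k + 1)) S ^ 2) / γs ω k
        ≤ 2 * Lt * D ^ 2 * c (K - 1) := by
    intro ω
    obtain ⟨m, rfl⟩ : ∃ m, K = m + 1 := ⟨K - 1, by omega⟩
    have h1 := aux_tele (fun k => Metric.infDist (x ω k) S ^ 2) (γs ω) (D ^ 2) m
      (fun k hk => hD ω k hk) (fun k hk => hγpos ω k (by omega))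
      (fun k hk => hγmono ω k (by omega))
    refine h1.trans ?_
    rw [Nat.add_sub_cancel]
    have hγ := hγpos ω m (by omega)
    rw [div_le_iff₀ hγ]
    have h2 := hlow ω m (by omega)
    rw [div_le_iff₀ (by positivity)] at h2
    have h3 := mul_le_mul_of_nonneg_left h2 (sq_nonneg D)
    have h4 : 0 ≤ Metric.infDist (x ω (m+1)) S ^ 2 := sq_nonneg _
    linarith
  -- conclude
  have hN : (0:ℝ) < (n:ℝ) ^ K := by positivity
  have hcard : ∀ r : ℝ, ∑ _ω : Fin K → Fin n, r = (n:ℝ)^K * r := by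
    intro r; simp
  refine aux_final K hK (fun k => (1 / (n : ℝ) ^ K) * ∑ ω : Fin K → Fin n, (f (x ω k) - fstar))
    c (α - β) β σint2 _ hA ?_
  refine le_of_mul_le_mul_left ?_ hN
  rw [← hcard (2 * Lt * D ^ 2 * c (K - 1))]
  refine le_trans ?_ (Finset.sum_le_sum fun ω _ => htel ω)
  rw [Finset.sum_comm, Finset.mul_sum]
  refine Finset.sum_le_sum fun k hk => ?_
  refine le_trans (le_of_eq ?_) (hsum ⟨k, Finset.mem_range.1 hk⟩)
  simp only
  simp only [Finset.sum_sub_distrib, hcard, ← Finset.mul_sum]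
  field_simp
end

section
/- Convergence of NGN with decreasing stepsize parameter under the α-β-condition: Suppose f satisfies the α-β-condition on ℝ^d with parameters α > β > 0 and α ≥ β + 1, each f_i is L-smooth and positive (f_i(x) > 0 for all x), σ_int² is finite, and σ_pos² := (1/n)∑_{i=1}^n f_i* is finite. Run x^{k+1} = x^k − γ_k ∇f_{i_k}(x^k) with γ_k := γ̃_k/(1 + (γ̃_k/(2 f_{i_k}(x^k)))·‖∇f_{i_k}(x^k)‖²), where γ̃_k := γ/√(k+1), γ > 0. Then, with C_1 := 5(1+γL)(1+2γL)/(8γ), C_2 := 15Lγ(1+γL)(1+2γL)/2, C_3 := (1+γL)(1+2γL), and C_4 := 5(1+γL)(1+2γL)γL·max{2γL − 1, 0}/2, min_{0 ≤ k < K} E[f(x^k) − f*] ≤ (C_1/√K)·dist(x^0,𝒮)² + (C_2·log(K+1)/√K)·α·σ_int² + (C_3/(α − β))·β·σ_int² + (C_4·log(K+1)/√K)·σ_pos². -/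
open scoped RealInnerProductSpace BigOperators

lemma aux_scalar (u l f p m : ℝ) (hu : 0 < u) (hl : 0 < l) (hl1 : l ≤ 1) (hp : 0 ≤ p) (hpf : p ≤ f)
    (hm : 2 * u - 1 ≤ m) (hm0 : 0 ≤ m) (h : l * u * p ≤ f * (l * (1 + u) - 1)) :
    l * (1 - l) * f * (1 + 2 * u) ≤ 2 * u * l * (f - p) + u * m * (1 + 2 * u) * p := by
  have hf : 0 ≤ f := hp.trans hpf
  rcases le_or_gt ((1 + 2 * u) * l) 2 with hc | hc
  · have h1 : 0 ≤ (1 - l) * (2 - (1 + 2 * u) * l) * f :=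
      mul_nonneg (mul_nonneg (by linarith) (by linarith)) hf
    have h2 : 0 ≤ u * m * (1 + 2 * u) * p := by positivity
    nlinarith
  · have h0 : 0 < 2 * u - 1 := by nlinarith
    have h1 : (1 - l) * (1 + 2 * u) ≤ 2 * u - 1 := by nlinarith
    have h2 : 0 ≤ ((1 + 2 * u) * l - 1) * (f - p) * l :=
      mul_nonneg (mul_nonneg (by linarith) (by linarith)) hl.le
    have h3 : l * ((1 - l) * (1 + 2 * u)) ≤ 1 * (2 * u - 1) :=
      mul_le_mul hl1 h1 (mul_nonneg (by linarith) (by linarith)) (by norm_num)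
    have h4 : 2 * u - 1 ≤ u * m * (1 + 2 * u) := by
      have : (2 * u - 1) * 1 ≤ m * (u * (1 + 2 * u)) :=
        mul_le_mul hm (by nlinarith) (by norm_num) hm0
      linarith
    have h5 : l * ((1 - l) * (1 + 2 * u)) * p ≤ u * m * (1 + 2 * u) * p :=
      mul_le_mul_of_nonneg_right (by linarith) hp
    nlinarith

lemma aux_descent_s5 {E : Type*} [NormedAddCommGroup E] [InnerProductSpace ℝ E] [CompleteSpace E]
    (F : E → ℝ) (hd : Differentiable ℝ F) (L : ℝ) (hL : 0 < L)
    (hs : ∀ x y : E, ‖gradient F x - gradient F y‖ ≤ L * ‖x - y‖) (x v : E) :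
    F (x + v) ≤ F x + ⟪gradient F x, v⟫ + L / 2 * ‖v‖ ^ 2 := by
  have hder : ∀ t : ℝ, HasDerivAt (fun t : ℝ => F (x + t • v) - t * ⟪gradient F x, v⟫
      - L / 2 * ‖v‖ ^ 2 * t ^ 2)
      (⟪gradient F (x + t • v), v⟫ - ⟪gradient F x, v⟫ - L * ‖v‖ ^ 2 * t) t := by
    intro t
    have h1 : HasFDerivAt F _ (x + t • v) := (hd (x + t • v)).hasGradientAt.hasFDerivAt
    have h2 : HasDerivAt (fun t : ℝ => x + t • v) v t := by
      simpa using ((hasDerivAt_id t).smul_const v).const_add x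
    have h3 := h1.comp_hasDerivAt t h2
    have h4 := (hasDerivAt_id t).mul_const ⟪gradient F x, v⟫
    have h5 := ((hasDerivAt_pow 2 t).const_mul (L / 2 * ‖v‖ ^ 2))
    have h6 := (h3.sub h4).sub h5
    have e : ⟪gradient F (x + t • v), v⟫ - ⟪gradient F x, v⟫ - L * ‖v‖ ^ 2 * t =
      (InnerProductSpace.toDual ℝ E (gradient F (x + t • v))) v - 1 * ⟪gradient F x, v⟫
        - L / 2 * ‖v‖ ^ 2 * (((2 : ℕ) : ℝ) * t ^ (2 - 1)) := by
      rw [InnerProductSpace.toDual_apply_apply]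
      norm_num
      ring
    rw [e]
    exact h6
  have hanti : AntitoneOn (fun t : ℝ => F (x + t • v) - t * ⟪gradient F x, v⟫
      - L / 2 * ‖v‖ ^ 2 * t ^ 2) (Set.Icc 0 1) := by
    apply antitoneOn_of_deriv_nonpos (convex_Icc 0 1)
    · exact fun t _ => (hder t).continuousAt.continuousWithinAt
    · exact fun t _ => (hder t).differentiableAt.differentiableWithinAt
    · intro t ht
      rw [interior_Icc] at ht
      rw [(hder t).deriv, ← inner_sub_left]
      have h1 := real_inner_le_norm (gradient F (x + t • v) - gradient F x) v
      have h2 := hs (x + t • v) x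
      rw [add_sub_cancel_left, norm_smul, Real.norm_of_nonneg ht.1.le] at h2
      nlinarith [mul_le_mul_of_nonneg_right h2 (norm_nonneg v)]
  have := hanti (Set.left_mem_Icc.2 zero_le_one) (Set.right_mem_Icc.2 zero_le_one) zero_le_one
  simp only [one_smul, zero_smul, add_zero] at this
  linarith

lemma aux_grad {E : Type*} [NormedAddCommGroup E] [InnerProductSpace ℝ E] [CompleteSpace E]
    (F : E → ℝ) (hd : Differentiable ℝ F) (L : ℝ) (hL : 0 < L)
    (hs : ∀ x y : E, ‖gradient F x - gradient F y‖ ≤ L * ‖x - y‖) (p : ℝ) (hp : ∀ x, p ≤ F x)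
    (x : E) : ‖gradient F x‖ ^ 2 ≤ 2 * L * (F x - p) := by
  have h := aux_descent_s5 F hd L hL hs x (-(1 / L) • gradient F x)
  have h2 := hp (x + -(1 / L) • gradient F x)
  rw [inner_smul_right, real_inner_self_eq_norm_sq, norm_smul, mul_pow, norm_neg,
    Real.norm_of_nonneg (by positivity : 0 ≤ 1 / L)] at h
  have h3 : -(1 / L) * ‖gradient F x‖ ^ 2 + L / 2 * ((1 / L) ^ 2 * ‖gradient F x‖ ^ 2)
    = -(‖gradient F x‖ ^ 2 / (2 * L)) := by field_simp; ring
  have h4 : ‖gradient F x‖ ^ 2 / (2 * L) ≤ F x - p := by linarith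
  rw [div_le_iff₀ (by positivity)] at h4
  linarith

/-- one-step bound, scalar part -/
lemma aux_step (s L f p G m t : ℝ) (hs : 0 < s) (hL : 0 < L) (hf : 0 < f) (hp : 0 ≤ p)
    (hpf : p ≤ f) (hG0 : 0 ≤ G) (hG : G ≤ 2 * L * (f - p)) (hm : 2 * s * L - 1 ≤ m) (hm0 : 0 ≤ m)
    (ht : t = s / (1 + s / (2 * f) * G)) :
    s / (1 + s * L) ≤ t ∧ t ≤ s ∧
    t ^ 2 * G ≤ 2 * t * (2 * s * L / (1 + 2 * s * L)) * (f - p) + 2 * s ^ 2 * L * m * p := by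
  have hden : 0 < 1 + s / (2 * f) * G := by positivity
  have ht0 : 0 < t := by rw [ht]; positivity
  have hts : t ≤ s := by
    rw [ht]; apply div_le_self hs.le; have : 0 ≤ s / (2 * f) * G := by positivity
    linarith
  have hq : s / (2 * f) * G ≤ s * L * (f - p) / f := by
    rw [div_mul_eq_mul_div, div_le_div_iff₀ (by positivity) hf]
    nlinarith [mul_le_mul_of_nonneg_left hG (mul_pos hs hf).le]
  have hq2 : s * L * (f - p) / f ≤ s * L := by
    rw [div_le_iff₀ hf]; nlinarith [mul_nonneg (mul_pos hs hL).le hp]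
  have hl : ∃ l, l = t / s := ⟨_, rfl⟩
  obtain ⟨l, hl⟩ := hl
  have htl : t = s * l := by rw [hl]; field_simp
  have hl0 : 0 < l := by rw [hl]; positivity
  have hl1 : l ≤ 1 := by rw [hl, div_le_one hs]; exact hts
  have hleq : l * (1 + s / (2 * f) * G) = 1 := by
    rw [hl, ht]; field_simp
  refine ⟨?_, hts, ?_⟩
  · rw [ht]
    apply div_le_div_of_nonneg_left hs.le hden; linarith
  · have h1 : l * (s * L) * p ≤ f * (l * (1 + s * L) - 1) := by
      have h := mul_le_mul_of_nonneg_left hq (mul_pos hl0 hf).le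
      have e : l * f * (s * L * (f - p) / f) = l * (s * L) * (f - p) := by field_simp
      rw [e] at h
      nlinarith
    have key := aux_scalar (s * L) l f p m (by positivity) hl0 hl1 hp hpf (by linarith) hm0 h1
    have hG2 : t ^ 2 * G = 2 * s * (l * (1 - l) * f) := by
      have : l * s * G = 2 * f * (1 - l) := by
        have : l * (s / (2 * f) * G) = 1 - l := by linarith
        field_simp at this
        linarith
      rw [htl]; linear_combination s * l * this
    have hpos : 0 < 1 + 2 * s * L := by positivity
    have e : 2 * t * (2 * s * L / (1 + 2 * s * L)) * (f - p) + 2 * s ^ 2 * L * m * p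
       = 2 * s * ((2 * (s * L) * l * (f - p) + (s * L) * m * (1 + 2 * (s * L)) * p) / (1 + 2 * s * L)) := by
      rw [htl]; field_simp
    rw [hG2, e]
    apply mul_le_mul_of_nonneg_left _ (by positivity)
    rw [le_div_iff₀ hpos]
    linarith

lemma aux_avg {n K : ℕ} (k : Fin K) (H : (Fin K → Fin n) → ℝ) :
    ∑ ω : Fin K → Fin n, ∑ i : Fin n, H (Function.update ω k i) = n * ∑ ω, H ω := by
  have hinv : Function.Involutive (fun q : (Fin K → Fin n) × Fin n =>
      (Function.update q.1 k q.2, q.1 k)) := by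
    intro q; ext <;> simp
  rw [← Fintype.sum_prod_type' (f := fun (ω : Fin K → Fin n) (i : Fin n) => H (Function.update ω k i))]
  rw [Fintype.sum_equiv hinv.toPerm (fun q : (Fin K → Fin n) × Fin n => H (Function.update q.1 k q.2))
    (fun q => H q.1) (fun q => rfl)]
  rw [Fintype.sum_prod_type, Finset.mul_sum]
  simp

lemma aux_harm (K : ℕ) (hK : 0 < K) :
    ∑ k ∈ Finset.range K, 1 / ((k : ℝ) + 1) ≤ 5 / 2 * Real.log (K + 1) := by
  have h := harmonic_le_one_add_log K
  have e : ((harmonic K : ℚ) : ℝ) = ∑ k ∈ Finset.range K, 1 / ((k : ℝ) + 1) := by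
    simp [harmonic]
  rw [← e]
  have h1 : Real.log K ≤ Real.log (K + 1) := 
    Real.log_le_log (by exact_mod_cast hK) (by linarith)
  have h2 : Real.log 2 ≤ Real.log (K + 1) := 
    Real.log_le_log (by norm_num) (by have : (1:ℝ) ≤ K := by exact_mod_cast hK
                                      linarith)
  have := Real.log_two_gt_d9
  linarith

lemma aux_sqrt (K : ℕ) :
    Real.sqrt K ≤ ∑ k ∈ Finset.range K, 1 / Real.sqrt ((k : ℝ) + 1) := by
  rcases Nat.eq_zero_or_pos K with rfl | hK
  · simp
  have hKr : (0:ℝ) < K := by exact_mod_cast hK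
  have : ∑ k ∈ Finset.range K, 1 / Real.sqrt K ≤ ∑ k ∈ Finset.range K, 1 / Real.sqrt ((k : ℝ) + 1) := by
    apply Finset.sum_le_sum
    intro k hk
    have : (k:ℝ) + 1 ≤ K := by exact_mod_cast Finset.mem_range.1 hk
    apply one_div_le_one_div_of_le (Real.sqrt_pos.2 (by positivity)) (Real.sqrt_le_sqrt this)
  refine le_trans (le_of_eq ?_) this
  simp
  rw [← div_eq_mul_inv, Real.div_sqrt]

lemma aux_dist {E : Type*} [NormedAddCommGroup E] [InnerProductSpace ℝ E]
    (S : Set E) (z xp g : E) (t : ℝ) (hxp : xp ∈ S) (hd : dist z xp = Metric.infDist z S) :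
    Metric.infDist (z - t • g) S ^ 2 ≤
      Metric.infDist z S ^ 2 - 2 * t * ⟪g, z - xp⟫ + t ^ 2 * ‖g‖ ^ 2 := by
  have h1 : Metric.infDist (z - t • g) S ≤ dist (z - t • g) xp := Metric.infDist_le_dist_of_mem hxp
  have h2 := pow_le_pow_left₀ Metric.infDist_nonneg h1 2
  refine h2.trans (le_of_eq ?_)
  rw [← hd, dist_eq_norm, dist_eq_norm, show z - t • g - xp = (z - xp) - t • g by abel,
    norm_sub_sq_real, inner_smul_right, norm_smul, mul_pow, Real.norm_eq_abs, sq_abs,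
    real_inner_comm]
  ring

lemma aux_comb (s L α β t ip G M a b p : ℝ) (hs : 0 < s) (hL : 0 < L) (hαβ : β + 1 ≤ α)
    (hα : 0 ≤ α) (ha : 0 ≤ a) (hb : 0 ≤ b) (hip : α * (a - b) - β * a ≤ ip)
    (ht : s / (1 + s * L) ≤ t) (hts : t ≤ s)
    (hG : t ^ 2 * G ≤ 2 * t * (2 * s * L / (1 + 2 * s * L)) * a + M * p) :
    - 2 * t * ip + t ^ 2 * G ≤
      - (2 * s * (α - β) / ((1 + s * L) * (1 + 2 * s * L))) * a + 2 * s * α * b + M * p := by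
  have ht0 : 0 < t := lt_of_lt_of_le (by positivity) ht
  have h1 : 2 * s * L / (1 + 2 * s * L) = 1 - 1 / (1 + 2 * s * L) := by field_simp; ring
  have h2 : 2 * s * (α - β) / ((1 + s * L) * (1 + 2 * s * L))
      = 2 * (s / (1 + s * L)) * ((α - β) * (1 / (1 + 2 * s * L))) := by field_simp
  rw [h1] at hG
  rw [h2]
  have hr1 : 1 / (1 + 2 * s * L) ≤ 1 := by
    rw [div_le_one (by positivity)]; have : 0 < s * L := by positivity
    linarith
  have hr0 : 0 < 1 / (1 + 2 * s * L) := by positivity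
  generalize 1 / (1 + 2 * s * L) = r at *
  generalize s / (1 + s * L) = q at *
  have e1 : 2 * t * (α * (a - b) - β * a) ≤ 2 * t * ip := 
    mul_le_mul_of_nonneg_left hip (by positivity)
  have e2 : q * ((α - β) * r * a) ≤ t * ((α - β) * r * a) :=
    mul_le_mul_of_nonneg_right ht (mul_nonneg (mul_nonneg (by linarith) hr0.le) ha)
  have e3 : t * (α * b) ≤ s * (α * b) := mul_le_mul_of_nonneg_right hts (by positivity)
  have e4 : 0 ≤ t * a * ((α - β - 1) * (1 - r)) :=
    mul_nonneg (by positivity) (mul_nonneg (by linarith) (by linarith))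
  nlinarith

lemma aux_rec (s g L α β σ P m X D D' : ℝ) (hs : 0 < s) (hsg : s ≤ g) (hL : 0 < L)
    (hαβ : β + 1 ≤ α) (hσ : 0 ≤ σ) (hX : 0 ≤ X)
    (h : D' ≤ D - (2 * s * (α - β) / ((1 + s * L) * (1 + 2 * s * L))) * (X + σ) + 2 * s * α * σ
      + 2 * s ^ 2 * L * m * P) :
    D' ≤ D - s * (2 * (α - β) / ((1 + g * L) * (1 + 2 * g * L)) * X)
       + s * (2 * β * σ) + s ^ 2 * (6 * L * (α - β) * σ + 2 * L * m * P) := by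
  have h1 : s * (2 * (α - β) / ((1 + g * L) * (1 + 2 * g * L)) * X) ≤
      2 * s * (α - β) / ((1 + s * L) * (1 + 2 * s * L)) * X := by
    rw [← mul_assoc]
    apply mul_le_mul_of_nonneg_right _ hX
    rw [mul_div_assoc', show s * (2 * (α - β)) = 2 * s * (α - β) by ring]
    apply div_le_div_of_nonneg_left (mul_nonneg (by positivity) (by linarith)) (by positivity)
    have hg : 0 < g := hs.trans_le hsg
    gcongr
  have h2 : 1 - 3 * (s * L) ≤ 1 / ((1 + s * L) * (1 + 2 * s * L)) := by
    rw [le_div_iff₀ (by positivity)]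
    have hu : 0 < s * L := by positivity
    rw [show 2 * s * L = 2 * (s * L) by ring]
    generalize s * L = u at *
    nlinarith [mul_pos hu hu, mul_pos hu (mul_pos hu hu)]
  have h3 : 2 * s * (α - β) * σ * (1 - 3 * (s * L)) ≤ 
      2 * s * (α - β) * σ * (1 / ((1 + s * L) * (1 + 2 * s * L))) :=
    mul_le_mul_of_nonneg_left h2 (mul_nonneg (mul_nonneg (by positivity) (by linarith)) hσ)
  have h4 : 2 * s * (α - β) / ((1 + s * L) * (1 + 2 * s * L)) * σ = 
     2 * s * (α - β) * σ * (1 / ((1 + s * L) * (1 + 2 * s * L))) := by ring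
  nlinarith

lemma aux_final_s5 (K : ℕ) (hK : 0 < K) (γ L α β σ P m : ℝ) (hγ : 0 < γ) (hL : 0 < L) (hβ : 0 < β)
    (hαβ : β + 1 ≤ α) (hσ : 0 ≤ σ) (hP : 0 ≤ P) (hm : 0 ≤ m) (C R : ℝ) (hC : 0 < C)
    (D E : ℕ → ℝ) (hD : ∀ k, 0 ≤ D k)
    (hrec : ∀ k < K, D (k + 1) ≤ D k - γ / Real.sqrt ((k : ℝ) + 1) * (2 * (α - β) / C * E k)
       + γ / Real.sqrt ((k : ℝ) + 1) * (2 * β * σ)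
       + (γ / Real.sqrt ((k : ℝ) + 1)) ^ 2 * (6 * L * (α - β) * σ + 2 * L * m * P))
    (hR : R = 5 * C / (8 * γ) / Real.sqrt K * D 0
       + 15 * L * γ * C / 2 * Real.log (K + 1) / Real.sqrt K * (α * σ)
       + C / (α - β) * (β * σ) + 5 * C * γ * L * m / 2 * Real.log (K + 1) / Real.sqrt K * P) :
    ∃ k < K, E k ≤ R := by
  by_contra! hcon
  have hab : 0 < α - β := by linarith
  have hKr : (0:ℝ) < K := by exact_mod_cast hK
  set s : ℕ → ℝ := fun k => γ / Real.sqrt ((k : ℝ) + 1) with hsdef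
  have hs0 : ∀ k, 0 < s k := fun k => div_pos hγ (Real.sqrt_pos.2 (by positivity))
  set B := 6 * L * (α - β) * σ + 2 * L * m * P with hB
  have hB0 : 0 ≤ B := by positivity
  have htel : ∀ N ≤ K, D N ≤ D 0 + ∑ k ∈ Finset.range N,
      (- (s k * (2 * (α - β) / C * R)) + s k * (2 * β * σ) + s k ^ 2 * B) := by
    intro N
    induction N with
    | zero => simp
    | succ N ih =>
      intro hN
      rw [Finset.sum_range_succ]
      have h1 := ih (by omega)
      have h2 := hrec N (by omega)
      have h3 : s N * (2 * (α - β) / C * R) ≤ s N * (2 * (α - β) / C * E N) :=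
        mul_le_mul_of_nonneg_left (mul_le_mul_of_nonneg_left (hcon N (by omega)).le
          (by positivity)) (hs0 N).le
      change D (N + 1) ≤ D N - s N * (2 * (α - β) / C * E N) + s N * (2 * β * σ) + s N ^ 2 * B at h2
      linarith
  have hlast : D K < D 0 + ∑ k ∈ Finset.range K,
      (- (s k * (2 * (α - β) / C * R)) + s k * (2 * β * σ) + s k ^ 2 * B) := by
    obtain ⟨N, rfl⟩ : ∃ N, K = N + 1 := ⟨K - 1, by omega⟩
    rw [Finset.sum_range_succ]
    have h1 := htel N (by omega)
    have h2 := hrec N (by omega)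
    have h3 : s N * (2 * (α - β) / C * R) < s N * (2 * (α - β) / C * E N) :=
      mul_lt_mul_of_pos_left (mul_lt_mul_of_pos_left (hcon N (by omega))
          (by positivity)) (hs0 N)
    change D (N + 1) ≤ D N - s N * (2 * (α - β) / C * E N) + s N * (2 * β * σ) + s N ^ 2 * B at h2
    linarith
  rw [Finset.sum_add_distrib, Finset.sum_add_distrib, Finset.sum_neg_distrib, ← Finset.sum_mul,
    ← Finset.sum_mul, ← Finset.sum_mul] at hlast
  have hT : γ * Real.sqrt K ≤ ∑ k ∈ Finset.range K, s k := by
    have := mul_le_mul_of_nonneg_left (aux_sqrt K) hγ.le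
    rw [Finset.mul_sum] at this
    simpa [hsdef, div_eq_mul_inv] using this
  have hQ : ∑ k ∈ Finset.range K, s k ^ 2 ≤ γ ^ 2 * (5 / 2 * Real.log (K + 1)) := by
    have := mul_le_mul_of_nonneg_left (aux_harm K hK) (sq_nonneg γ)
    rw [Finset.mul_sum] at this
    refine le_trans (le_of_eq (Finset.sum_congr rfl fun k _ => ?_)) this
    simp only [hsdef]
    rw [div_pow, Real.sq_sqrt (by positivity)]
    ring
  have hl0 : 0 ≤ Real.log (K + 1) := Real.log_nonneg (by linarith)
  generalize Real.log (K + 1) = l at *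
  generalize (∑ k ∈ Finset.range K, s k) = T at *
  generalize (∑ k ∈ Finset.range K, s k ^ 2) = Q at *
  have hr : 0 < Real.sqrt K := Real.sqrt_pos.2 hKr
  generalize Real.sqrt K = r at *
  have hDK := hD K
  have hD0 := hD 0
  have hQB := mul_le_mul_of_nonneg_right hQ hB0
  -- expand
  have hv : γ ≤ T / r := by rw [le_div_iff₀ hr]; exact hT
  have e : T * (2 * (α - β) / C * R) = (T / r) * (5 / (4 * γ) * (α - β) * D 0)
      + (T / r) * (15 * L * γ * l * (α - β) * (α * σ)) + T * (2 * β * σ)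
      + (T / r) * (5 * γ * L * m * l * (α - β) * P) := by
    rw [hR]; field_simp; ring
  have hα : 0 < α := by linarith
  have i1 := mul_le_mul_of_nonneg_right hv (by positivity : 0 ≤ 5 / (4 * γ) * (α - β) * D 0)
  have i2 := mul_le_mul_of_nonneg_right hv
    (by positivity : 0 ≤ 15 * L * γ * l * (α - β) * (α * σ))
  have i3 := mul_le_mul_of_nonneg_right hv
    (by positivity : 0 ≤ 5 * γ * L * m * l * (α - β) * P)
  have e1 : γ * (5 / (4 * γ) * (α - β) * D 0) = 5 / 4 * (α - β) * D 0 := by field_simp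
  have j1 : 0 ≤ (α - β - 1) * D 0 := mul_nonneg (by linarith) hD0
  have j2 : 0 ≤ (α - 1) * (15 * L * γ ^ 2 * l * (α - β) * σ) :=
    mul_nonneg (by linarith) (by positivity)
  have j3 : 0 ≤ (α - β - 1) * (5 * γ ^ 2 * L * m * l * P) :=
    mul_nonneg (by linarith) (by positivity)
  rw [e, hB] at hlast
  rw [hB] at hQB
  rw [e1] at i1
  nlinarith


/-- Convergence of NGN with decreasing stepsize parameter under the α-β-condition. -/
theorem ngn_decreasing_abc
    {d n : ℕ} (hn : 0 < n)
    (F : Fin n → EuclideanSpace ℝ (Fin d) → ℝ)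
    (hdiff : ∀ i, Differentiable ℝ (F i))
    (hpos : ∀ i (x : EuclideanSpace ℝ (Fin d)), 0 < F i x)
    (hbdd : ∀ i, BddBelow (Set.range (F i)))
    (Fstar : Fin n → ℝ) (hFstar : ∀ i, Fstar i = ⨅ x, F i x)
    (f : EuclideanSpace ℝ (Fin d) → ℝ)
    (hf : f = fun x => (1 / (n : ℝ)) * ∑ i, F i x)
    (S : Set (EuclideanSpace ℝ (Fin d)))
    (hS : S = {x | ∀ y, f x ≤ f y}) (hSne : S.Nonempty)
    (fstar : ℝ) (hfstar : fstar = ⨅ x, f x)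
    (σint2 : ℝ) (hσ : σint2 = fstar - (1 / (n : ℝ)) * ∑ i, Fstar i)
    (σpos2 : ℝ) (hσpos : σpos2 = (1 / (n : ℝ)) * ∑ i, Fstar i)
    (α β L : ℝ) (hβ : 0 < β) (hαβ : β < α) (hα1 : β + 1 ≤ α) (hL : 0 < L)
    (habc : ∀ x : EuclideanSpace ℝ (Fin d), ∃ xp ∈ S,
      dist x xp = Metric.infDist x S ∧
      ∀ i, α * (F i x - F i xp) - β * (F i x - Fstar i)
        ≤ ⟪gradient (F i) x, x - xp⟫)
    (hsmooth : ∀ i (x y : EuclideanSpace ℝ (Fin d)),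
      ‖gradient (F i) x - gradient (F i) y‖ ≤ L * ‖x - y‖)
    (γ : ℝ) (hγ : 0 < γ)
    (K : ℕ) (hK : 0 < K)
    (x0 : EuclideanSpace ℝ (Fin d))
    (x : (Fin K → Fin n) → ℕ → EuclideanSpace ℝ (Fin d))
    (hx0 : ∀ ω, x ω 0 = x0)
    (hstep : ∀ ω (k : Fin K),
      x ω ((k : ℕ) + 1)
        = x ω k
          - ((γ / Real.sqrt ((k : ℕ) + 1))
              / (1 + (γ / Real.sqrt ((k : ℕ) + 1)) / (2 * F (ω k) (x ω k))
                    * ‖gradient (F (ω k)) (x ω k)‖ ^ 2))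
            • gradient (F (ω k)) (x ω k))
    (C1 C2 C3 C4 : ℝ)
    (hC1 : C1 = 5 * (1 + γ * L) * (1 + 2 * γ * L) / (8 * γ))
    (hC2 : C2 = 15 * L * γ * (1 + γ * L) * (1 + 2 * γ * L) / 2)
    (hC3 : C3 = (1 + γ * L) * (1 + 2 * γ * L))
    (hC4 : C4 = 5 * (1 + γ * L) * (1 + 2 * γ * L) * γ * L * max (2 * γ * L - 1) 0 / 2) :
    ∃ k < K,
      (1 / (n : ℝ) ^ K) * ∑ ω : Fin K → Fin n, (f (x ω k) - fstar)
        ≤ C1 / Real.sqrt K * Metric.infDist x0 S ^ 2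
          + C2 * Real.log (K + 1) / Real.sqrt K * (α * σint2)
          + C3 / (α - β) * (β * σint2)
          + C4 * Real.log (K + 1) / Real.sqrt K * σpos2 := by
  have hnr : (0:ℝ) < n := by exact_mod_cast hn
  have hα : 0 < α := by linarith
  have hp : ∀ i z, Fstar i ≤ F i z := fun i z => by rw [hFstar]; exact ciInf_le (hbdd i) z
  have hp0 : ∀ i, 0 ≤ Fstar i := fun i => by
    rw [hFstar]; exact le_ciInf fun z => (hpos i z).le
  have hfS : ∀ z ∈ S, f z = fstar := by
    intro z hz
    rw [hS] at hz
    rw [hfstar]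
    exact le_antisymm (le_ciInf hz) (ciInf_le ⟨f z, by rintro _ ⟨y, rfl⟩; exact hz y⟩ z)
  have hfge : ∀ z, fstar ≤ f z := by
    intro z
    obtain ⟨y, hy⟩ := hSne
    rw [← hfS y hy]
    rw [hS] at hy
    exact hy z
  have hsumF : ∀ z, ∑ i, F i z = n * f z := by
    intro z; rw [hf]; field_simp
  have hsumP : ∑ i, Fstar i = n * σpos2 := by rw [hσpos]; field_simp
  have hσ' : σint2 = fstar - σpos2 := by rw [hσ, hσpos]
  have hP0 : 0 ≤ σpos2 := by
    rw [hσpos]; exact mul_nonneg (by positivity) (Finset.sum_nonneg fun i _ => hp0 i)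
  have hσ0 : 0 ≤ σint2 := by
    obtain ⟨y, hy⟩ := hSne
    have h1 : ∑ i, Fstar i ≤ ∑ i, F i y := Finset.sum_le_sum fun i _ => hp i y
    rw [hsumF, hsumP, hfS y hy] at h1
    rw [hσ']
    have := le_of_mul_le_mul_left h1 hnr
    linarith
  set m := max (2 * γ * L - 1) 0 with hm
  -- one step of the method
  let step : ℝ → Fin n → EuclideanSpace ℝ (Fin d) → EuclideanSpace ℝ (Fin d) := fun s i z =>
    z - (s / (1 + s / (2 * F i z) * ‖gradient (F i) z‖ ^ 2)) • gradient (F i) z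
  have hone : ∀ s, 0 < s → s ≤ γ → ∀ z, ∑ i, Metric.infDist (step s i z) S ^ 2 ≤
      n * (Metric.infDist z S ^ 2
        - (2 * s * (α - β) / ((1 + s * L) * (1 + 2 * s * L))) * (f z - fstar + σint2)
        + 2 * s * α * σint2 + 2 * s ^ 2 * L * m * σpos2) := by
    intro s hs hsγ z
    obtain ⟨xp, hxp, hdist, hin⟩ := habc z
    have hi : ∀ i, Metric.infDist (step s i z) S ^ 2 ≤ Metric.infDist z S ^ 2
        - (2 * s * (α - β) / ((1 + s * L) * (1 + 2 * s * L))) * (F i z - Fstar i)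
        + 2 * s * α * (F i xp - Fstar i) + 2 * s ^ 2 * L * m * Fstar i := by
      intro i
      have h1 := aux_dist S z xp (gradient (F i) z)
        (s / (1 + s / (2 * F i z) * ‖gradient (F i) z‖ ^ 2)) hxp hdist
      have hG := aux_grad (F i) (hdiff i) L hL (hsmooth i) (Fstar i) (hp i) z
      have hms : 2 * s * L - 1 ≤ m := by
        refine le_trans ?_ (le_max_left _ _)
        gcongr
      obtain ⟨a1, a2, a3⟩ := aux_step s L (F i z) (Fstar i) (‖gradient (F i) z‖ ^ 2) m _ hs hL
        (hpos i z) (hp0 i) (hp i z) (by positivity) hG hms (le_max_right _ _) rfl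
      have h2 := aux_comb s L α β _ ⟪gradient (F i) z, z - xp⟫ (‖gradient (F i) z‖ ^ 2)
        (2 * s ^ 2 * L * m) (F i z - Fstar i) (F i xp - Fstar i) (Fstar i) hs hL hα1 hα.le
        (by linarith [hp i z]) (by linarith [hp i xp])
        (by have := hin i; linarith) a1 a2 a3
      simp only [step]
      linarith
    refine (Finset.sum_le_sum fun i _ => hi i).trans (le_of_eq ?_)
    simp only [Finset.sum_add_distrib, Finset.sum_sub_distrib, ← Finset.mul_sum, hsumF, hsumP,
      hfS xp hxp]
    simp only [Finset.sum_const, Finset.card_univ, Fintype.card_fin, nsmul_eq_mul]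
    rw [hσ']
    ring
  -- the iterates depend on the past only
  have hpast : ∀ k, k ≤ K → ∀ ω ω' : Fin K → Fin n, (∀ j : Fin K, (j : ℕ) < k → ω j = ω' j) →
      x ω k = x ω' k := by
    intro k
    induction k with
    | zero => intro _ ω ω' _; rw [hx0, hx0]
    | succ k ih =>
      intro hk ω ω' h
      have e := ih (by omega) ω ω' (fun j hj => h j (by omega))
      have e2 := h ⟨k, by omega⟩ (by simp)
      have h1 := hstep ω ⟨k, by omega⟩
      have h2 := hstep ω' ⟨k, by omega⟩
      simp only at h1 h2
      rw [h1, h2, e, e2]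
  have hNpos : (0:ℝ) < (n:ℝ) ^ K := by positivity
  have hcard : ∑ _ω : Fin K → Fin n, (1:ℝ) = (n:ℝ) ^ K := by simp
  have hC3pos : 0 < C3 := by rw [hC3]; positivity
  have hfin := aux_final_s5 K hK γ L α β σint2 σpos2 m hγ hL hβ hα1 hσ0 hP0 (le_max_right _ _) C3
    (C1 / Real.sqrt K * Metric.infDist x0 S ^ 2
          + C2 * Real.log (K + 1) / Real.sqrt K * (α * σint2)
          + C3 / (α - β) * (β * σint2)
          + C4 * Real.log (K + 1) / Real.sqrt K * σpos2) hC3pos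
    (fun k => (1 / (n : ℝ) ^ K) * ∑ ω : Fin K → Fin n, Metric.infDist (x ω k) S ^ 2)
    (fun k => (1 / (n : ℝ) ^ K) * ∑ ω : Fin K → Fin n, (f (x ω k) - fstar))
    (fun k => mul_nonneg (by positivity) (Finset.sum_nonneg fun ω _ => sq_nonneg _))
    ?_ ?_
  · exact hfin
  · intro k hk
    have hsq : 1 ≤ Real.sqrt ((k : ℝ) + 1) := by
      rw [Real.one_le_sqrt]; linarith [(Nat.cast_nonneg k : (0:ℝ) ≤ k)]
    have hs : 0 < γ / Real.sqrt ((k : ℝ) + 1) := by positivity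
    have hsγ : γ / Real.sqrt ((k : ℝ) + 1) ≤ γ := div_le_self hγ.le hsq
    have hst : ∀ ω, x ω (k + 1) = step (γ / Real.sqrt ((k : ℝ) + 1)) (ω ⟨k, hk⟩) (x ω k) :=
      fun ω => hstep ω ⟨k, hk⟩
    generalize γ / Real.sqrt ((k : ℝ) + 1) = s at *
    have hX : 0 ≤ (1 / (n : ℝ) ^ K) * ∑ ω : Fin K → Fin n, (f (x ω k) - fstar) :=
      mul_nonneg (by positivity) (Finset.sum_nonneg fun ω _ => by linarith [hfge (x ω k)])
    rw [hC3]
    refine aux_rec s γ L α β σint2 σpos2 m _ _ _ hs hsγ hL hα1 hσ0 hX ?_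
    have havg := aux_avg (n := n) ⟨k, hk⟩ (fun ω => Metric.infDist (x ω (k + 1)) S ^ 2)
    have hupd : ∀ ω i, x (Function.update ω ⟨k, hk⟩ i) (k + 1) = step s i (x ω k) := by
      intro ω i
      rw [hst, Function.update_self]
      congr 1
      apply hpast k hk.le
      intro j hj
      rw [Function.update_of_ne]
      rintro rfl
      simp at hj
    simp only [hupd] at havg
    have hle := Finset.sum_le_sum fun (ω : Fin K → Fin n) (_ : ω ∈ Finset.univ) =>
      hone s hs hsγ (x ω k)
    rw [havg, ← Finset.mul_sum] at hle
    have hle2 := mul_le_mul_of_nonneg_left (le_of_mul_le_mul_left hle hnr)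
      (by positivity : 0 ≤ 1 / (n:ℝ) ^ K)
    refine hle2.trans (le_of_eq ?_)
    simp only [Finset.sum_add_distrib, Finset.sum_sub_distrib, ← Finset.mul_sum]
    simp only [Finset.sum_const, Finset.card_univ, Fintype.card_fun, Fintype.card_fin,
      nsmul_eq_mul]
    push_cast
    generalize 2 * s * (α - β) / ((1 + s * L) * (1 + 2 * s * L)) = A
    field_simp
  · have e : (1 / (n : ℝ) ^ K) * ∑ ω : Fin K → Fin n, Metric.infDist (x ω 0) S ^ 2
        = Metric.infDist x0 S ^ 2 := by
      simp only [hx0, Finset.sum_const, Finset.card_univ, Fintype.card_fun, Fintype.card_fin,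
        nsmul_eq_mul]
      push_cast
      field_simp
    simp only [e]
    rw [hC1, hC2, hC4, hC3]
    ring
end

section
/- Example 10 (local minima): Let f_1(x,y) = (1 + x² + y²)/(4 + x² + y²), f_2(x,y) = ((x−2.5)² + (y−2.5)²)/(4 + (x−2.5)² + (y−2.5)²), and f = (f_1 + f_2)/2 on ℝ². Then inf f_1 = 1/4 (attained at the origin), inf f_2 = 0 (attained at (2.5, 2.5)), the set 𝒮 of global minimizers of f is nonempty, and there exist parameters α > β > 0 with α − β = 1 such that for every (x,y) ∈ ℝ² and every nearest point (z,t) of (x,y) in 𝒮, for i = 1, 2: ⟨∇f_i(x,y), (x−z, y−t)⟩ ≥ α(f_i(x,y) − f_i(z,t)) − β(f_i(x,y) − f_i*), where f_1* = 1/4 and f_2* = 0. In particular, f satisfies the α-β-condition on ℝ² with some α and β = α − 1, even though f has a non-global local minimum. -/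
open scoped RealInnerProductSpace BigOperators

lemma aux_grad_s9 (k a b : ℝ) (p v : EuclideanSpace ℝ (Fin 2)) :
    ⟪gradient (fun p : EuclideanSpace ℝ (Fin 2) =>
      1 - k / (4 + (p 0 - a) ^ 2 + (p 1 - b) ^ 2)) p, v⟫
    = 2 * k * ((p 0 - a) * v 0 + (p 1 - b) * v 1) / (4 + (p 0 - a) ^ 2 + (p 1 - b) ^ 2) ^ 2 := by
  have hne : (4 + (p 0 - a) ^ 2 + (p 1 - b) ^ 2) ≠ 0 := by positivity
  have h0 : HasFDerivAt (fun p : EuclideanSpace ℝ (Fin 2) => p 0)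
      (EuclideanSpace.proj (0 : Fin 2) : EuclideanSpace ℝ (Fin 2) →L[ℝ] ℝ) p :=
    (EuclideanSpace.proj (0 : Fin 2) : EuclideanSpace ℝ (Fin 2) →L[ℝ] ℝ).hasFDerivAt
  have h1 : HasFDerivAt (fun p : EuclideanSpace ℝ (Fin 2) => p 1)
      (EuclideanSpace.proj (1 : Fin 2) : EuclideanSpace ℝ (Fin 2) →L[ℝ] ℝ) p :=
    (EuclideanSpace.proj (1 : Fin 2) : EuclideanSpace ℝ (Fin 2) →L[ℝ] ℝ).hasFDerivAt
  have hD := (((h0.sub_const a).pow 2).const_add 4).add ((h1.sub_const b).pow 2)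
  have hG : HasDerivAt (fun t : ℝ => 1 - k / t)
      (k / (4 + (p 0 - a) ^ 2 + (p 1 - b) ^ 2) ^ 2) (4 + (p 0 - a) ^ 2 + (p 1 - b) ^ 2) := by
    have := ((hasDerivAt_inv hne).const_mul k).const_sub 1
    simp only [div_eq_mul_inv]
    exact this.congr_deriv (by ring)
  have hF := HasDerivAt.comp_hasFDerivAt (f := fun p : EuclideanSpace ℝ (Fin 2) =>
      4 + (p 0 - a) ^ 2 + (p 1 - b) ^ 2) p hG hD
  have hF' : fderiv ℝ (fun p : EuclideanSpace ℝ (Fin 2) =>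
      1 - k / (4 + (p 0 - a) ^ 2 + (p 1 - b) ^ 2)) p = _ := hF.fderiv
  rw [gradient, InnerProductSpace.toDual_symm_apply, hF']
  simp
  ring

lemma aux_grad_bound (k a b : ℝ) (hk : 0 ≤ k) (p q : EuclideanSpace ℝ (Fin 2)) :
    - (k * ((q 0 - a) ^ 2 + (q 1 - b) ^ 2) / 32) ≤
    ⟪gradient (fun p : EuclideanSpace ℝ (Fin 2) =>
      1 - k / (4 + (p 0 - a) ^ 2 + (p 1 - b) ^ 2)) p, p - q⟫ := by
  rw [aux_grad_s9]
  have hD : 16 ≤ (4 + (p 0 - a) ^ 2 + (p 1 - b) ^ 2) ^ 2 := by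
    nlinarith [sq_nonneg (p 0 - a), sq_nonneg (p 1 - b)]
  simp only [PiLp.sub_apply]
  set D := (4 + (p 0 - a) ^ 2 + (p 1 - b) ^ 2) ^ 2
  set W := (q 0 - a) ^ 2 + (q 1 - b) ^ 2 with hW
  have hW0 : 0 ≤ W := by positivity
  rw [le_div_iff₀ (by linarith)]
  have h1 : -(W / 4) ≤ (p 0 - a) * (p 0 - q 0) + (p 1 - b) * (p 1 - q 1) := by
    nlinarith [sq_nonneg ((p 0 - a) - (q 0 - a) / 2), sq_nonneg ((p 1 - b) - (q 1 - b) / 2)]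
  have h2 := mul_le_mul_of_nonneg_left h1 hk
  have h3 := mul_le_mul_of_nonneg_left hD (mul_nonneg hk hW0)
  nlinarith

set_option maxHeartbeats 4000000 in
theorem example_ten_abc
    (f1 f2 f : EuclideanSpace ℝ (Fin 2) → ℝ)
    (hf1 : f1 = fun p => (1 + (p 0) ^ 2 + (p 1) ^ 2) / (4 + (p 0) ^ 2 + (p 1) ^ 2))
    (hf2 : f2 = fun p =>
      ((p 0 - 2.5) ^ 2 + (p 1 - 2.5) ^ 2) / (4 + (p 0 - 2.5) ^ 2 + (p 1 - 2.5) ^ 2))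
    (hf : f = fun p => (f1 p + f2 p) / 2)
    (S : Set (EuclideanSpace ℝ (Fin 2)))
    (hS : S = {p | ∀ q, f p ≤ f q}) :
    (⨅ p, f1 p) = 1 / 4 ∧ f1 0 = 1 / 4 ∧
    (⨅ p, f2 p) = 0 ∧
    (∀ q : EuclideanSpace ℝ (Fin 2), q 0 = 2.5 → q 1 = 2.5 → f2 q = 0) ∧
    S.Nonempty ∧
    (∃ α β : ℝ, 0 < β ∧ β < α ∧ α - β = 1 ∧
      ∀ p : EuclideanSpace ℝ (Fin 2), ∀ q ∈ S, dist p q = Metric.infDist p S →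
        (α * (f1 p - f1 q) - β * (f1 p - 1 / 4) ≤ ⟪gradient f1 p, p - q⟫ ∧
         α * (f2 p - f2 q) - β * (f2 p - 0) ≤ ⟪gradient f2 p, p - q⟫)) := by
  have e1 : f1 = fun p => 1 - 3 / (4 + (p 0 - 0) ^ 2 + (p 1 - 0) ^ 2) := by
    rw [hf1]; funext p
    have : (4 + (p 0) ^ 2 + (p 1) ^ 2) ≠ 0 := by positivity
    simp only [sub_zero]
    field_simp; ring
  have e2 : f2 = fun p => 1 - 4 / (4 + (p 0 - 2.5) ^ 2 + (p 1 - 2.5) ^ 2) := by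
    rw [hf2]; funext p
    have : (4 + (p 0 - 2.5) ^ 2 + (p 1 - 2.5) ^ 2) ≠ 0 := by positivity
    rw [eq_sub_iff_add_eq, ← add_div, div_eq_one_iff_eq this]; ring
  have a1 : ∀ p, f1 p = 1 - 3 / (4 + (p 0 ^ 2 + p 1 ^ 2)) := by
    intro p; rw [e1]; simp [add_assoc]
  have a2 : ∀ p, f2 p = 1 - 4 / (4 + ((p 0 - 2.5) ^ 2 + (p 1 - 2.5) ^ 2)) := by
    intro p; rw [e2]; simp [add_assoc]
  have l1 : ∀ p, 1 / 4 ≤ f1 p := by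
    intro p; rw [a1]
    have : 3 / (4 + (p 0 ^ 2 + p 1 ^ 2)) ≤ 3 / 4 := by
      apply div_le_div_of_nonneg_left <;> first | positivity | (have : 0 ≤ p 0 ^ 2 + p 1 ^ 2 := by positivity
                                                                linarith)
    linarith
  have l2 : ∀ p, 0 ≤ f2 p := by
    intro p; rw [hf2]; positivity
  have u1 : ∀ p, f1 p ≤ 1 := by
    intro p; rw [a1]
    have : 0 ≤ 3 / (4 + (p 0 ^ 2 + p 1 ^ 2)) := by positivity
    linarith
  have u2 : ∀ p, f2 p ≤ 1 := by
    intro p; rw [a2]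
    have : 0 ≤ 4 / (4 + ((p 0 - 2.5) ^ 2 + (p 1 - 2.5) ^ 2)) := by positivity
    linarith
  have z1 : f1 0 = 1 / 4 := by rw [a1]; norm_num
  have z2 : ∀ q : EuclideanSpace ℝ (Fin 2), q 0 = 2.5 → q 1 = 2.5 → f2 q = 0 := by
    intro q h0 h1; rw [a2, h0, h1]; norm_num
  -- comparison points
  have key : ∀ q, f q ≤ f !₂[2.375, 2.375] →
      q 0 ^ 2 + q 1 ^ 2 ≤ 100 ∧ 0.01 ≤ q 0 ^ 2 + q 1 ^ 2 ∧
      0.001 ≤ (q 0 - 2.5) ^ 2 + (q 1 - 2.5) ^ 2 := by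
    intro q hq
    rw [hf] at hq
    simp only [a1, a2] at hq
    have hv : 1.188 ≤ 3 / (4 + (q 0 ^ 2 + q 1 ^ 2)) +
        4 / (4 + ((q 0 - 2.5) ^ 2 + (q 1 - 2.5) ^ 2)) := by
      norm_num at hq ⊢
      linarith
    set A := q 0 ^ 2 + q 1 ^ 2 with hA
    set B := (q 0 - 2.5) ^ 2 + (q 1 - 2.5) ^ 2 with hB
    have hA0 : 0 ≤ A := by positivity
    have hB0 : 0 ≤ B := by positivity
    have t : ∀ k x y : ℝ, 0 ≤ k → 0 ≤ y → y ≤ x → k / (4 + x) ≤ k / (4 + y) := by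
      intro k x y hk hy hxy
      apply div_le_div_of_nonneg_left hk <;> linarith
    have i1 : A ≤ 2 * B + 25 := by
      rw [hA, hB]; nlinarith [sq_nonneg (q 0 - 5), sq_nonneg (q 1 - 5)]
    have i2 : 12.5 ≤ 2 * A + 2 * B := by
      rw [hA, hB]; nlinarith [sq_nonneg (4 * q 0 - 5), sq_nonneg (4 * q 1 - 5)]
    have i3 : 12.5 ≤ 1.02 * A + 51 * B := by
      have h : ∀ x : ℝ, 6.25 ≤ 1.02 * x ^ 2 + 51 * (x - 2.5) ^ 2 := by
        intro x; nlinarith [sq_nonneg (x - 2.5 * 51 / 52.02)]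
      have := h (q 0); have := h (q 1)
      rw [hA, hB]; linarith
    refine ⟨?_, ?_, ?_⟩
    · by_contra! h
      have := t 3 A 100 (by norm_num) (by norm_num) h.le
      have := t 4 B 37.5 (by norm_num) (by norm_num) (by linarith)
      norm_num at *
      linarith
    · by_contra! h
      have := t 3 A 0 (by norm_num) (by norm_num) hA0
      have := t 4 B 6.24 (by norm_num) (by norm_num) (by norm_num at *; linarith)
      norm_num at *
      linarith
    · by_contra! h
      have := t 3 A 12 (by norm_num) (by norm_num) (by norm_num at *; linarith)
      have := t 4 B 0 (by norm_num) (by norm_num) hB0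
      norm_num at *
      linarith
  have hcont : Continuous f := by
    have c1 : Continuous f1 := by
      rw [hf1]
      exact Continuous.div (by fun_prop) (by fun_prop) (fun p => by positivity)
    have c2 : Continuous f2 := by
      rw [hf2]
      exact Continuous.div (by fun_prop) (by fun_prop) (fun p => by positivity)
    rw [hf]; fun_prop
  refine ⟨?_, z1, ?_, z2, ?_, ?_⟩
  · apply le_antisymm
    · rw [← z1]; exact ciInf_le ⟨1 / 4, by rintro _ ⟨p, rfl⟩; exact l1 p⟩ 0
    · exact le_ciInf l1
  · apply le_antisymm
    · rw [← z2 !₂[2.5, 2.5] (by simp) (by simp)]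
      exact ciInf_le ⟨0, by rintro _ ⟨p, rfl⟩; exact l2 p⟩ _
    · exact le_ciInf l2
  · obtain ⟨m, hm⟩ := hcont.exists_forall_le_of_isBounded !₂[2.375, 2.375] (by
      apply (Metric.isBounded_closedBall (x := (0 : EuclideanSpace ℝ (Fin 2))) (r := 10)).subset
      intro q hq
      have := (key q hq).1
      rw [mem_closedBall_zero_iff, EuclideanSpace.norm_eq]
      apply Real.sqrt_le_iff.mpr
      simp [Fin.sum_univ_two]
      linarith)
    exact ⟨m, by rw [hS]; exact hm⟩
  · refine ⟨200001, 200000, by norm_num, by norm_num, by norm_num, ?_⟩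
    intro p q hq _
    rw [hS] at hq
    obtain ⟨b1, b2, b3⟩ := key q (hq _)
    constructor
    · have g := aux_grad_bound 3 0 0 (by norm_num) p q
      rw [← e1] at g
      have : 0.001 ≤ f1 q - 1 / 4 := by
        rw [a1]
        have : 3 / (4 + (q 0 ^ 2 + q 1 ^ 2)) ≤ 3 / 4.01 := by
          apply div_le_div_of_nonneg_left <;> norm_num at * <;> linarith
        norm_num at *
        linarith
      have := u1 p
      have := l1 q
      norm_num at *
      linarith
    · have g := aux_grad_bound 4 2.5 2.5 (by norm_num) p q
      rw [← e2] at g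
      have : 0.0002 ≤ f2 q := by
        rw [a2]
        have : 4 / (4 + ((q 0 - 2.5) ^ 2 + (q 1 - 2.5) ^ 2)) ≤ 4 / 4.001 := by
          apply div_le_div_of_nonneg_left <;> norm_num at * <;> linarith
        norm_num at *
        linarith
      have hB : (q 0 - 2.5) ^ 2 + (q 1 - 2.5) ^ 2 ≤ 225 := by
        nlinarith [sq_nonneg (q 0 + 2.5), sq_nonneg (q 1 + 2.5)]
      have := u2 p
      norm_num at *
      linarith
end
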